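/- Assume additionally that the Fourier transform ĩk(λ) = ∫ ik(x)e^{iλx} dx satisfies ĩk(λ) = O(|λ|^{−3}) as λ → ∞. For m ∈ ℤ and t ∈ ℝ define the Fourier coefficient ψ̃_m(t) := ∫_ℝ (𝓗 ik')(q) · w(−q − t) · e^{2πi m q} dq. Then there exists a constant c > 0 such that |ψ̃_m(t)| ≤ c (1 + m²)^{−1} (1 + t²)^{−1} for all m ∈ ℤ and t ∈ ℝ; in particular, the Fourier series Σ_m ψ̃_m(t) e^{−2πimq} of ψ(q,t) := Σ_{j∈ℤ}(𝓗 ik')(q − j) w(j − q − t) converges absolutely. -/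

import Mathlib

open MeasureTheory Filter Topology

lemma abs_integral_sin_div_le_of_one_le {a b : ℝ} (ha : 1 ≤ a) (hab : a ≤ b) :
    |∫ u in a..b, Real.sin u / u| ≤ 3 := by
  have hpos : ∀ u ∈ Set.uIcc a b, 0 < u := fun u hu => by
    rw [Set.uIcc_of_le hab] at hu; linarith [hu.1]
  have hc : IntervalIntegrable (fun u : ℝ => Real.cos u / u ^ 2) volume a b := by
    refine ContinuousOn.intervalIntegrable (Real.continuous_cos.continuousOn.div (by fun_prop) ?_)
    intro u hu
    have := hpos u hu
    positivity
  have hs : IntervalIntegrable (fun u : ℝ => Real.sin u / u) volume a b := by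
    refine ContinuousOn.intervalIntegrable (Real.continuous_sin.continuousOn.div (by fun_prop) ?_)
    intro u hu
    exact (hpos u hu).ne'
  have hi : IntervalIntegrable (fun u : ℝ => (u ^ 2)⁻¹) volume a b := by
    refine ContinuousOn.intervalIntegrable (ContinuousOn.inv₀ (by fun_prop) ?_)
    intro u hu
    have := hpos u hu
    positivity
  have key : ∫ u in a..b, (Real.sin u / u + Real.cos u / u ^ 2)
      = -(Real.cos b / b) - -(Real.cos a / a) := by
    refine intervalIntegral.integral_eq_sub_of_hasDerivAt (f := fun u => -(Real.cos u / u)) ?_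
      (hs.add hc)
    intro u hu
    have hu := hpos u hu
    refine ((Real.hasDerivAt_cos u).div (hasDerivAt_id u) hu.ne').neg.congr_deriv ?_
    simp only [id]
    field_simp
    ring
  have key2 : ∫ u in a..b, (u ^ 2)⁻¹ = -b⁻¹ - -a⁻¹ := by
    refine intervalIntegral.integral_eq_sub_of_hasDerivAt (f := fun u => -u⁻¹) ?_ hi
    intro u hu
    have hu := hpos u hu
    exact (hasDerivAt_inv hu.ne').neg.congr_deriv (neg_neg _)
  have hcos : |∫ u in a..b, Real.cos u / u ^ 2| ≤ ∫ u in a..b, (u ^ 2)⁻¹ := by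
    rw [← Real.norm_eq_abs]
    refine intervalIntegral.norm_integral_le_of_norm_le hab ?_ hi
    refine ae_of_all _ fun u _ => ?_
    rw [Real.norm_eq_abs, abs_div, abs_of_nonneg (sq_nonneg u), div_eq_mul_inv]
    exact mul_le_of_le_one_left (by positivity) (Real.abs_cos_le_one u)
  rw [intervalIntegral.integral_add hs hc] at key
  have cb : ∀ x : ℝ, 1 ≤ x → |Real.cos x / x| ≤ x⁻¹ := fun x hx => by
    rw [abs_div, abs_of_pos (by linarith : 0 < x), div_eq_mul_inv]
    exact mul_le_of_le_one_left (by positivity) (Real.abs_cos_le_one x)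
  have h1 := abs_le.1 (cb a ha)
  have h2 := abs_le.1 (cb b (ha.trans hab))
  have h3 := abs_le.1 hcos
  have h4 : a⁻¹ ≤ 1 := inv_le_one_of_one_le₀ ha
  have h5 : 0 < b⁻¹ := inv_pos.2 (by linarith)
  rw [abs_le]
  constructor <;> linarith [h1.1, h1.2, h2.1, h2.2, h3.1, h3.2]

lemma intervalIntegrable_sin_div (a b : ℝ) :
    IntervalIntegrable (fun u : ℝ => Real.sin u / u) volume a b := by
  refine (Real.continuous_sinc.intervalIntegrable a b).congr_ae (ae_restrict_of_ae ?_)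
  filter_upwards [compl_mem_ae_iff.2 (measure_singleton (0 : ℝ))] with u hu
  exact Real.sinc_of_ne_zero hu

lemma abs_integral_sin_div_le_of_le_one {a b : ℝ} (ha : 0 ≤ a) (hab : a ≤ b) (hb : b ≤ 1) :
    |∫ u in a..b, Real.sin u / u| ≤ 1 := by
  have : ‖∫ u in a..b, Real.sin u / u‖ ≤ 1 * |b - a| := by
    refine intervalIntegral.norm_integral_le_of_norm_le_const fun u _ => ?_
    rw [Real.norm_eq_abs, abs_div]
    exact div_le_one_of_le₀ Real.abs_sin_le_abs (abs_nonneg u)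
  rw [Real.norm_eq_abs, abs_of_nonneg (sub_nonneg.2 hab)] at this
  linarith

lemma abs_integral_sin_div_le {a b : ℝ} (ha : 0 ≤ a) (hab : a ≤ b) :
    |∫ u in a..b, Real.sin u / u| ≤ 4 := by
  rcases le_total b 1 with hb | hb
  · linarith [abs_integral_sin_div_le_of_le_one ha hab hb]
  rcases le_total 1 a with h | h
  · linarith [abs_integral_sin_div_le_of_one_le h hab]
  rw [← intervalIntegral.integral_add_adjacent_intervals (intervalIntegrable_sin_div a 1)
    (intervalIntegrable_sin_div 1 b)]
  linarith [abs_integral_sin_div_le_of_one_le le_rfl hb,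
    abs_integral_sin_div_le_of_le_one ha h le_rfl,
    abs_add_le (∫ u in a..1, Real.sin u / u) (∫ u in (1:ℝ)..b, Real.sin u / u)]

lemma abs_integral_sin_mul_div_le {a b : ℝ} (ha : 0 ≤ a) (hab : a ≤ b) (x : ℝ) :
    |∫ u in a..b, Real.sin (x * u) / u| ≤ 4 := by
  have hpos : ∀ y : ℝ, 0 < y → |∫ u in a..b, Real.sin (y * u) / u| ≤ 4 := fun y hy => by
    have h := intervalIntegral.integral_comp_mul_left (a := a) (b := b)
      (fun v => Real.sin v / v) hy.ne'
    have h2 : ∀ u : ℝ, Real.sin (y * u) / u = y * (Real.sin (y * u) / (y * u)) := fun u => by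
      field_simp
    simp_rw [h2]
    rw [intervalIntegral.integral_const_mul, h, smul_eq_mul, mul_inv_cancel_left₀ hy.ne']
    exact abs_integral_sin_div_le (by positivity) (by gcongr)
  rcases lt_trichotomy x 0 with h | h | h
  · have := hpos (-x) (by linarith)
    simpa [neg_div] using this
  · simp [h]
  · exact hpos x h

lemma norm_exp_two_pi_I_mul (x p : ℝ) :
    ‖Complex.exp (2 * Real.pi * Complex.I * x * p)‖ = 1 := by
  rw [← Complex.norm_exp_ofReal_mul_I (2 * Real.pi * x * p)]
  congr 2; push_cast; ring

/-- Two integrations by parts for an oscillatory integral with vanishing boundary terms. -/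
lemma norm_integral_mul_exp_le {h h' h'' : ℝ → ℝ} {a b K : ℝ} (hab : a ≤ b)
    (hd : ∀ p ∈ Set.Icc a b, HasDerivAt h (h' p) p)
    (hd' : ∀ p ∈ Set.Icc a b, HasDerivAt h' (h'' p) p)
    (hm : Measurable h'')
    (hK : ∀ p ∈ Set.Icc a b, |h p| ≤ K)
    (hK'' : ∀ᵐ p : ℝ, p ∈ Set.Icc a b → |h'' p| ≤ K)
    (ha : h a = 0) (hb : h b = 0) (ha' : h' a = 0) (hb' : h' b = 0) (x : ℝ) :
    ‖∫ p in a..b, (h p : ℂ) * Complex.exp (2 * Real.pi * Complex.I * x * p)‖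
      ≤ 2 * K * (b - a) * (1 + x ^ 2)⁻¹ := by
  have hsub : Set.uIoc a b ⊆ Set.Icc a b := by
    rw [Set.uIoc_of_le hab]; exact Set.Ioc_subset_Icc_self
  have hnorm := norm_exp_two_pi_I_mul x
  have hexpc : Continuous fun p : ℝ => Complex.exp (2 * Real.pi * Complex.I * x * p) := by
    fun_prop
  have hK0 : 0 ≤ K := (abs_nonneg _).trans (hK a ⟨le_rfl, hab⟩)
  have hint'' : IntervalIntegrable
      (fun p => (h'' p : ℂ) * Complex.exp (2 * Real.pi * Complex.I * x * p)) volume a b := by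
    rw [intervalIntegrable_iff]
    refine Measure.integrableOn_of_bounded (M := K) ?_ ?_ ?_
    · rw [Set.uIoc_of_le hab]; exact measure_Ioc_lt_top.ne
    · exact ((Complex.measurable_ofReal.comp hm).mul hexpc.measurable).aestronglyMeasurable
    · rw [ae_restrict_iff' measurableSet_uIoc]
      filter_upwards [hK''] with p hp hpm
      rw [norm_mul, hnorm, mul_one, Complex.norm_real]
      exact hp (hsub hpm)
  have hint : IntervalIntegrable
      (fun p => (h p : ℂ) * Complex.exp (2 * Real.pi * Complex.I * x * p)) volume a b := by
    refine ContinuousOn.intervalIntegrable (ContinuousOn.mul ?_ hexpc.continuousOn)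
    rw [Set.uIcc_of_le hab]
    exact Complex.continuous_ofReal.comp_continuousOn
      fun p hp => (hd p hp).continuousAt.continuousWithinAt
  have key : ∫ p in a..b, ((h'' p : ℂ) * Complex.exp (2 * Real.pi * Complex.I * x * p)
      + ((2 * Real.pi * x) ^ 2 : ℂ) *
        ((h p : ℂ) * Complex.exp (2 * Real.pi * Complex.I * x * p))) = 0 := by
    rw [intervalIntegral.integral_eq_sub_of_hasDerivAt
      (f := fun p : ℝ => ((h' p : ℂ) - 2 * Real.pi * Complex.I * x * h p) *
        Complex.exp (2 * Real.pi * Complex.I * x * p)) ?_ (hint''.add (hint.const_mul _))]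
    · simp [ha, hb, ha', hb']
    · intro p hp
      rw [Set.uIcc_of_le hab] at hp
      have h1 := (hd p hp).ofReal_comp
      have h2 := (hd' p hp).ofReal_comp
      have h3 : HasDerivAt (fun p : ℝ => Complex.exp (2 * Real.pi * Complex.I * x * p))
          (Complex.exp (2 * Real.pi * Complex.I * x * p) * (2 * Real.pi * Complex.I * x * 1)) p :=
        (((hasDerivAt_id p).ofReal_comp).const_mul _).cexp
      refine ((h2.sub (h1.const_mul (2 * Real.pi * Complex.I * x))).mul h3).congr_deriv ?_
      simp only [Pi.sub_apply]
      linear_combination (-(4 * Real.pi ^ 2 * x ^ 2 * h p *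
        Complex.exp (2 * Real.pi * Complex.I * x * p))) * Complex.I_sq
  rw [intervalIntegral.integral_add hint'' (hint.const_mul _),
    intervalIntegral.integral_const_mul] at key
  set J := ∫ p in a..b, (h p : ℂ) * Complex.exp (2 * Real.pi * Complex.I * x * p)
  have b1 : ‖J‖ ≤ K * (b - a) := by
    rw [← abs_of_nonneg (sub_nonneg.2 hab)]
    refine intervalIntegral.norm_integral_le_of_norm_le_const fun p hp => ?_
    rw [norm_mul, hnorm, mul_one, Complex.norm_real]
    exact hK p (hsub hp)
  have b2 : ‖∫ p in a..b, (h'' p : ℂ) * Complex.exp (2 * Real.pi * Complex.I * x * p)‖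
      ≤ K * (b - a) := by
    rw [← abs_of_nonneg (sub_nonneg.2 hab)]
    refine intervalIntegral.norm_integral_le_of_norm_le_const_ae ?_
    filter_upwards [hK''] with p hp hpm
    rw [norm_mul, hnorm, mul_one, Complex.norm_real]
    exact hp (hsub hpm)
  have b3 : (2 * Real.pi * x) ^ 2 * ‖J‖ ≤ K * (b - a) := by
    rw [add_eq_zero_iff_eq_neg] at key
    rw [key, norm_neg, norm_mul] at b2
    convert b2 using 2
    rw [← Complex.ofReal_ofNat, ← Complex.ofReal_mul, ← Complex.ofReal_mul, ← Complex.ofReal_pow,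
      Complex.norm_real, Real.norm_eq_abs, abs_of_nonneg (sq_nonneg _)]
  have hpi : x ^ 2 ≤ (2 * Real.pi * x) ^ 2 := by
    have := Real.pi_gt_three
    rw [mul_pow]
    exact le_mul_of_one_le_left (sq_nonneg _) (by nlinarith)
  rw [← div_eq_mul_inv, le_div_iff₀ (by positivity)]
  nlinarith [mul_le_mul_of_nonneg_right hpi (norm_nonneg J)]

/-- A truncated Hilbert transform as an integral of symmetric differences. -/
lemma setIntegral_div_sub_eq {f : ℝ → ℝ} (hf : Continuous f) {R N q δ : ℝ}
    (hR : ∀ x, R < |x| → f x = 0) (hN : |q| + R ≤ N) (hδ : 0 < δ) (hδN : δ < N) :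
    ∫ s in {s : ℝ | δ < |q - s|}, f s / (q - s) = ∫ u in δ..N, (f (q - u) - f (q + u)) / u := by
  have e1 : ∫ s in {s : ℝ | δ < |q - s|}, f s / (q - s)
      = ∫ u in {u : ℝ | δ < |u|}, f (q - u) / u := by
    have hm1 : MeasurableSet {s : ℝ | δ < |q - s|} := by measurability
    have hm2 : MeasurableSet {s : ℝ | δ < |s|} := by measurability
    rw [← integral_indicator hm1, ← integral_indicator hm2,
      ← integral_sub_left_eq_self _ volume q]
    congr 1
    ext u
    simp [Set.indicator]
  have hm : MeasurableSet {s : ℝ | δ < |s|} := by measurability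
  have e2 : ∫ u in {u : ℝ | δ < |u|}, f (q - u) / u
      = ∫ u in Set.Ioc δ N ∪ Set.Ico (-N) (-δ), f (q - u) / u := by
    refine setIntegral_eq_of_subset_of_forall_sdiff_eq_zero hm ?_ ?_
    · rintro u (hu | hu)
      · exact hu.1.trans_le (le_abs_self u)
      · exact lt_of_lt_of_le (by linarith [hu.2]) (neg_le_abs u)
    · intro u hu
      have hu1 : δ < |u| := hu.1
      have hNu : N < |u| := by
        by_contra! hcon
        apply hu.2
        rcases le_total 0 u with h | h
        · rw [abs_of_nonneg h] at *
          exact Or.inl ⟨hu1, hcon⟩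
        · rw [abs_of_nonpos h] at *
          exact Or.inr ⟨by linarith, by linarith⟩
      rw [hR, zero_div]
      have := abs_sub_abs_le_abs_sub u q
      rw [abs_sub_comm] at this
      linarith
  have hpos : ∀ u ∈ Set.Icc δ N, u ≠ 0 := fun u hu => (hδ.trans_le hu.1).ne'
  have i1 : IntervalIntegrable (fun u => f (q - u) / u) volume δ N := by
    refine ContinuousOn.intervalIntegrable (ContinuousOn.div (by fun_prop) (by fun_prop) ?_)
    rwa [Set.uIcc_of_le hδN.le]
  have i2 : IntervalIntegrable (fun u => f (q + u) / u) volume δ N := by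
    refine ContinuousOn.intervalIntegrable (ContinuousOn.div (by fun_prop) (by fun_prop) ?_)
    rwa [Set.uIcc_of_le hδN.le]
  have i3 : IntervalIntegrable (fun u => f (q - u) / u) volume (-N) (-δ) := by
    refine ContinuousOn.intervalIntegrable (ContinuousOn.div (by fun_prop) (by fun_prop) ?_)
    rw [Set.uIcc_of_le (by linarith)]
    intro u hu
    exact (show u < 0 by linarith [hu.2]).ne
  rw [e1, e2, setIntegral_union ?_ measurableSet_Ico
    ((intervalIntegrable_iff_integrableOn_Ioc_of_le hδN.le).1 i1)
    ((intervalIntegrable_iff_integrableOn_Ico_of_le (by linarith)).1 i3),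
    integral_Ico_eq_integral_Ioo, ← integral_Ioc_eq_integral_Ioo,
    ← intervalIntegral.integral_of_le hδN.le, ← intervalIntegral.integral_of_le (by linarith)]
  · simp_rw [sub_div]
    rw [intervalIntegral.integral_sub i1 i2, sub_eq_add_neg, ← intervalIntegral.integral_neg,
      ← intervalIntegral.integral_comp_neg]
    congr 2
    ext u
    rw [sub_neg_eq_add, div_neg]
  · rw [Set.disjoint_left]
    intro u h1 h2
    linarith [h1.1, h2.2]

open FourierTransform

lemma continuous_fourier_of_integrable {f : ℝ → ℂ} (hf : Integrable f) : Continuous (𝓕 f) :=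
  VectorFourier.fourierIntegral_continuous Real.continuous_fourierChar
    (by exact continuous_inner) hf

/-- A pointwise bound for the product of two decaying functions, one of them translated. -/
lemma inv_one_add_sq_mul_le (x m : ℝ) :
    (1 + x ^ 2)⁻¹ * (1 + (m + x) ^ 2)⁻¹
      ≤ 2 * (1 + m ^ 2)⁻¹ * ((1 + x ^ 2)⁻¹ + (1 + (m + x) ^ 2)⁻¹) := by
  have h : (1 + x ^ 2)⁻¹ + (1 + (m + x) ^ 2)⁻¹
      = ((1 + x ^ 2) + (1 + (m + x) ^ 2)) * ((1 + x ^ 2)⁻¹ * (1 + (m + x) ^ 2)⁻¹) := by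
    field_simp
    ring
  rw [h, ← mul_assoc]
  refine le_mul_of_one_le_left (by positivity) ?_
  rw [mul_right_comm, ← div_eq_mul_inv, le_div_iff₀ (by positivity)]
  nlinarith [sq_nonneg (m + 2 * x)]

lemma exists_norm_fourier_deriv_le {g : ℝ → ℝ} (hsupp : HasCompactSupport g)
    (hd : Differentiable ℝ g) (hc : Continuous (deriv g))
    (hdecay : ∃ C : ℝ, ∀ l : ℝ, 1 ≤ |l| →
      ‖∫ x : ℝ, (g x : ℂ) * Complex.exp (Complex.I * l * x)‖ ≤ C / |l| ^ 3) :
    ∃ C : ℝ, ∀ x : ℝ, ‖𝓕 (fun s : ℝ => ((deriv g s : ℝ) : ℂ)) x‖ ≤ C * (1 + x ^ 2)⁻¹ := by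
  obtain ⟨C, hC⟩ := hdecay
  have hgi : Integrable (fun s => (g s : ℂ)) :=
    (hd.continuous.integrable_of_hasCompactSupport hsupp).ofReal
  have hg'i : Integrable (fun s => ((deriv g s : ℝ) : ℂ)) :=
    (hc.integrable_of_hasCompactSupport hsupp.deriv).ofReal
  have hder : deriv (fun s => (g s : ℂ)) = fun s => ((deriv g s : ℝ) : ℂ) := by
    ext s
    exact ((hd s).hasDerivAt.ofReal_comp).deriv
  have hF : ∀ x : ℝ, 𝓕 (fun s => ((deriv g s : ℝ) : ℂ)) x
      = (2 * Real.pi * Complex.I * x) * ∫ s : ℝ, (g s : ℂ) *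
        Complex.exp (Complex.I * ((-(2 * Real.pi * x) : ℝ) : ℂ) * s) := fun x => by
    rw [← hder, Real.fourier_deriv hgi (fun s => ((hd s).hasDerivAt.ofReal_comp).differentiableAt)
      (by rwa [hder])]
    beta_reduce
    rw [Real.fourier_real_eq_integral_exp_smul, smul_eq_mul]
    congr 2
    ext s
    rw [smul_eq_mul, mul_comm]
    congr 2
    push_cast
    ring
  have hL1 : ∀ x : ℝ, ‖𝓕 (fun s => ((deriv g s : ℝ) : ℂ)) x‖ ≤ ∫ s, ‖((deriv g s : ℝ) : ℂ)‖ := fun x =>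
    VectorFourier.norm_fourierIntegral_le_integral_norm _ _ _ _ _
  have hL0 : 0 ≤ ∫ s, ‖((deriv g s : ℝ) : ℂ)‖ := by positivity
  have hC0 : 0 ≤ C := by
    have := (norm_nonneg _).trans (hC 1 (by simp))
    simpa using this
  refine ⟨2 * C + 2 * ∫ s, ‖((deriv g s : ℝ) : ℂ)‖, fun x => ?_⟩
  have hpi := Real.pi_gt_three
  rw [← div_eq_mul_inv, le_div_iff₀ (by positivity)]
  rcases le_total 1 |x| with hx | hx
  · have e : |(-(2 * Real.pi * x))| = 2 * Real.pi * |x| := by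
      rw [abs_neg, abs_mul, abs_of_pos (by positivity)]
    have hl : 1 ≤ |(-(2 * Real.pi * x))| := by rw [e]; nlinarith
    have h := hC _ hl
    rw [hF, norm_mul]
    have e2 : ‖(2 * Real.pi * Complex.I * x : ℂ)‖ = 2 * Real.pi * |x| := by
      simp [abs_of_pos Real.pi_pos]
    rw [e] at h
    rw [e2]
    have h2 : 2 * Real.pi * |x| * ‖∫ s : ℝ, (g s : ℂ) *
        Complex.exp (Complex.I * ((-(2 * Real.pi * x) : ℝ) : ℂ) * s)‖ ≤ C / |x| ^ 2 := by
      refine (mul_le_mul_of_nonneg_left h (by positivity)).trans ?_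
      rw [mul_div_assoc', div_le_div_iff₀ (by positivity) (by positivity)]
      have : 1 ≤ (2 * Real.pi) ^ 2 := by nlinarith
      have h3 : 0 ≤ 2 * Real.pi * |x| ^ 3 * C := by positivity
      nlinarith [mul_le_mul_of_nonneg_right this h3]
    refine (mul_le_mul_of_nonneg_right h2 (by positivity)).trans ?_
    rw [div_mul_eq_mul_div, div_le_iff₀ (by positivity), sq_abs]
    have hx2 : 1 ≤ x ^ 2 := by rw [← sq_abs]; nlinarith
    nlinarith [mul_nonneg hL0 (sq_nonneg x), mul_le_mul_of_nonneg_left hx2 hC0]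
  · have hx2 : x ^ 2 ≤ 1 := by rw [← sq_abs]; nlinarith [abs_nonneg x]
    have := hL1 x
    nlinarith [norm_nonneg (𝓕 (fun s => ((deriv g s : ℝ) : ℂ)) x)]

/-- Truncated Hilbert transforms as Fourier multipliers. -/
lemma integral_sub_div_eq_integral_fourier {f : ℝ → ℝ} (hf : Continuous f) (hfi : Integrable f)
    (hFi : Integrable (𝓕 (fun s => (f s : ℂ)))) {δ N : ℝ} (hδ : 0 < δ) (hN : δ ≤ N) (q : ℝ) :
    ((∫ u in δ..N, (f (q - u) - f (q + u)) / u : ℝ) : ℂ)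
      = ∫ x : ℝ, (𝓕 (fun s => (f s : ℂ)) x *
        (-2 * Complex.I * ((∫ u in δ..N, Real.sin (2 * Real.pi * x * u) / u : ℝ) : ℂ))) *
        Complex.exp (2 * Real.pi * Complex.I * x * q) := by
  set F := 𝓕 (fun s => (f s : ℂ)) with hF
  have hinv : ∀ y : ℝ, (f y : ℂ) = ∫ x : ℝ, F x * Complex.exp (2 * Real.pi * Complex.I * x * y) := by
    intro y
    have h := congrFun (Continuous.fourierInv_fourier_eq (f := fun s => (f s : ℂ))
      (Complex.continuous_ofReal.comp hf) hfi.ofReal hFi) y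
    rw [← h, Real.fourierInv_eq']
    congr 1
    ext x
    rw [smul_eq_mul, mul_comm]
    congr 2
    simp
    ring
  have hie : ∀ y : ℝ, Integrable fun x : ℝ => F x * Complex.exp (2 * Real.pi * Complex.I * x * y) :=
    fun y => by
    simp_rw [mul_comm (F _)]
    refine hFi.bdd_mul (c := 1) (Continuous.aestronglyMeasurable (by fun_prop))
      (ae_of_all _ fun x => (norm_exp_two_pi_I_mul x y).le)
  have hdiff : ∀ u : ℝ, (((f (q - u) - f (q + u)) / u : ℝ) : ℂ)
      = ∫ x : ℝ, (F x * Complex.exp (2 * Real.pi * Complex.I * x * q)) *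
        (-2 * Complex.I * ((Real.sin (2 * Real.pi * x * u) / u : ℝ) : ℂ)) := by
    intro u
    push_cast
    rw [hinv, hinv, ← integral_sub (hie _) (hie _), ← integral_div]
    congr 1
    ext x
    have e1 : Complex.exp (2 * Real.pi * Complex.I * x * ((q - u : ℝ) : ℂ))
        = Complex.exp (2 * Real.pi * Complex.I * x * q) *
          Complex.exp (-(2 * Real.pi * x * u) * Complex.I) := by
      rw [← Complex.exp_add]; congr 1; push_cast; ring
    have e2 : Complex.exp (2 * Real.pi * Complex.I * x * ((q + u : ℝ) : ℂ))
        = Complex.exp (2 * Real.pi * Complex.I * x * q) *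
          Complex.exp ((2 * Real.pi * x * u) * Complex.I) := by
      rw [← Complex.exp_add]; congr 1; push_cast; ring
    rw [e1, e2, Complex.sin]
    linear_combination ((F x * Complex.exp (2 * Real.pi * Complex.I * x * q) / u *
      (Complex.exp (-(2 * Real.pi * x * u) * Complex.I) -
        Complex.exp ((2 * Real.pi * x * u) * Complex.I)))) * Complex.I_sq
  rw [← intervalIntegral.integral_ofReal]
  simp_rw [hdiff]
  rw [intervalIntegral_integral_swap]
  · congr 1
    ext x
    rw [intervalIntegral.integral_const_mul, intervalIntegral.integral_const_mul,
      intervalIntegral.integral_ofReal]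
    ring
  · have hdom : Integrable (fun z : ℝ × ℝ => (2 / δ) * ‖F z.2‖)
        ((volume.restrict (Set.uIoc δ N)).prod volume) := by
      refine Integrable.mul_prod (f := fun _ : ℝ => 2 / δ) (g := fun x => ‖F x‖) ?_ hFi.norm
      exact intervalIntegrable_iff.1 intervalIntegrable_const
    have hFm : Measurable F := (continuous_fourier_of_integrable hfi.ofReal).measurable
    refine hdom.mono' ?_ ?_
    · refine Measurable.aestronglyMeasurable ?_
      simp only [Function.uncurry_def]
      fun_prop
    · rw [← Measure.restrict_univ (μ := (volume : Measure ℝ)), Measure.restrict_restrict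
        measurableSet_uIoc, Measure.prod_restrict, 
        ae_restrict_iff' ((measurableSet_uIoc.inter .univ).prod .univ)]
      refine ae_of_all _ fun z hz => ?_
      have hz1 : δ < z.1 := by
        have := hz.1.1
        rw [Set.uIoc_of_le hN] at this
        exact this.1
      have hz0 : 0 < z.1 := hδ.trans hz1
      simp only [Function.uncurry_def]
      rw [norm_mul, norm_mul, norm_exp_two_pi_I_mul, mul_one, mul_comm]
      refine mul_le_mul_of_nonneg_right ?_ (norm_nonneg _)
      rw [norm_mul, Complex.norm_real, Real.norm_eq_abs, abs_div, abs_of_pos hz0]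
      have : ‖(-2 * Complex.I : ℂ)‖ = 2 := by simp
      rw [this, div_eq_mul_inv 2 δ]
      have h1 := Real.abs_sin_le_one (2 * Real.pi * z.2 * z.1)
      refine mul_le_mul_of_nonneg_left ?_ (by norm_num)
      exact (div_le_div₀ zero_le_one h1 hδ hz1.le).trans_eq (one_div δ)

lemma norm_multiplier_le {δ N : ℝ} (hδ : 0 < δ) (hN : δ ≤ N) (x : ℝ) :
    ‖(-2 * Complex.I * ((∫ u in δ..N, Real.sin (2 * Real.pi * x * u) / u : ℝ) : ℂ))‖ ≤ 8 := by
  rw [norm_mul, Complex.norm_real, Real.norm_eq_abs]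
  have : ‖(-2 * Complex.I : ℂ)‖ = 2 := by simp
  rw [this]
  linarith [abs_integral_sin_mul_div_le hδ.le hN (2 * Real.pi * x)]

section TruncatedHilbert

variable {f : ℝ → ℝ} {C δ N : ℝ}

lemma integrable_of_norm_le_inv_one_add_sq {F : ℝ → ℂ} (hF : Continuous F)
    (hC : ∀ x, ‖F x‖ ≤ C * (1 + x ^ 2)⁻¹) : Integrable F :=
  (integrable_inv_one_add_sq.const_mul C).mono' hF.aestronglyMeasurable (ae_of_all _ hC)

lemma abs_integral_sub_div_le (hf : Continuous f) (hfi : Integrable f)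
    (hC : ∀ x, ‖𝓕 (fun s => (f s : ℂ)) x‖ ≤ C * (1 + x ^ 2)⁻¹)
    (hδ : 0 < δ) (hN : δ ≤ N) (q : ℝ) :
    |∫ u in δ..N, (f (q - u) - f (q + u)) / u| ≤ 8 * C * Real.pi := by
  have hFi := integrable_of_norm_le_inv_one_add_sq (continuous_fourier_of_integrable hfi.ofReal) hC
  rw [← Real.norm_eq_abs, ← Complex.norm_real, ← integral_univ_inv_one_add_sq,
    ← integral_const_mul, integral_sub_div_eq_integral_fourier hf hfi hFi hδ hN]
  refine MeasureTheory.norm_integral_le_of_norm_le (integrable_inv_one_add_sq.const_mul _)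
    (ae_of_all _ fun x => ?_)
  rw [norm_mul, norm_exp_two_pi_I_mul, mul_one, norm_mul]
  nlinarith [mul_le_mul (hC x) (norm_multiplier_le hδ hN x) (norm_nonneg _)
    ((norm_nonneg _).trans (hC x))]

lemma norm_integral_truncated_mul_exp_le (hf : Continuous f) (hfi : Integrable f)
    (hC : ∀ x, ‖𝓕 (fun s => (f s : ℂ)) x‖ ≤ C * (1 + x ^ 2)⁻¹)
    (hδ : 0 < δ) (hN : δ ≤ N) {g : ℝ → ℝ} {B : ℝ} (hg : Integrable g)
    (hB : ∀ x : ℝ, ‖∫ q : ℝ, (g q : ℂ) * Complex.exp (2 * Real.pi * Complex.I * x * q)‖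
      ≤ B * (1 + x ^ 2)⁻¹) (m : ℝ) :
    ‖∫ q : ℝ, (((∫ u in δ..N, (f (q - u) - f (q + u)) / u) * g q : ℝ) : ℂ) *
      Complex.exp (2 * Real.pi * Complex.I * m * q)‖
      ≤ 32 * C * B * Real.pi * (1 + m ^ 2)⁻¹ := by
  set F := 𝓕 (fun s => (f s : ℂ)) with hF
  have hFi : Integrable F :=
    integrable_of_norm_le_inv_one_add_sq (continuous_fourier_of_integrable hfi.ofReal) hC
  set k : ℝ → ℂ := fun x =>
    -2 * Complex.I * ((∫ u in δ..N, Real.sin (2 * Real.pi * x * u) / u : ℝ) : ℂ) with hk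
  have hkb : ∀ x, ‖k x‖ ≤ 8 := norm_multiplier_le hδ hN
  have hkm : Measurable k := by
    have : StronglyMeasurable fun x : ℝ => ∫ u in δ..N, Real.sin (2 * Real.pi * x * u) / u := by
      simp_rw [intervalIntegral.integral_of_le hN]
      refine StronglyMeasurable.integral_prod_right
        (f := fun x u : ℝ => Real.sin (2 * Real.pi * x * u) / u) ?_
      refine Measurable.stronglyMeasurable ?_
      simp only [Function.uncurry_def]
      fun_prop
    have := this.measurable
    fun_prop
  have hFk : Integrable fun x => F x * k x := by
    simp_rw [mul_comm (F _)]
    exact hFi.bdd_mul hkm.aestronglyMeasurable (ae_of_all _ hkb)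
  have hrep : ∀ q : ℝ, (((∫ u in δ..N, (f (q - u) - f (q + u)) / u) * g q : ℝ) : ℂ) *
      Complex.exp (2 * Real.pi * Complex.I * m * q)
      = ∫ x : ℝ, Complex.exp (2 * Real.pi * Complex.I * ((m + x : ℝ) : ℂ) * q) *
        ((g q : ℂ) * (F x * k x)) := fun q => by
    rw [Complex.ofReal_mul, integral_sub_div_eq_integral_fourier hf hfi hFi hδ hN, mul_assoc,
      ← integral_mul_const]
    congr 1
    ext x
    have : Complex.exp (2 * Real.pi * Complex.I * ((m + x : ℝ) : ℂ) * q)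
        = Complex.exp (2 * Real.pi * Complex.I * m * q) *
          Complex.exp (2 * Real.pi * Complex.I * x * q) := by
      rw [← Complex.exp_add]; congr 1; push_cast; ring
    rw [this]
    ring
  simp_rw [hrep]
  rw [integral_integral_swap]
  · have hin : ∀ x : ℝ, ∫ q : ℝ, Complex.exp (2 * Real.pi * Complex.I * ((m + x : ℝ) : ℂ) * q) *
        ((g q : ℂ) * (F x * k x)) = (F x * k x) *
        ∫ q : ℝ, (g q : ℂ) * Complex.exp (2 * Real.pi * Complex.I * ((m + x : ℝ) : ℂ) * q) :=
      fun x => by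
        rw [← integral_const_mul]
        congr 1
        ext q
        ring
    simp_rw [hin]
    have hC0 : 0 ≤ C := by simpa using (norm_nonneg _).trans (hC 0)
    have hB0 : 0 ≤ B := by simpa using (norm_nonneg _).trans (hB 0)
    have hshift : Integrable fun x : ℝ => (1 + (m + x) ^ 2)⁻¹ :=
      integrable_inv_one_add_sq.comp_add_left m
    have hI : ∫ x : ℝ, 16 * C * B * (1 + m ^ 2)⁻¹ * ((1 + x ^ 2)⁻¹ + (1 + (m + x) ^ 2)⁻¹)
        = 32 * C * B * Real.pi * (1 + m ^ 2)⁻¹ := by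
      rw [integral_const_mul, integral_add integrable_inv_one_add_sq hshift,
        integral_add_left_eq_self (fun x : ℝ => (1 + x ^ 2)⁻¹) m, integral_univ_inv_one_add_sq]
      ring
    rw [← hI]
    refine norm_integral_le_of_norm_le ((integrable_inv_one_add_sq.add hshift).const_mul _)
      (ae_of_all _ fun x => ?_)
    rw [norm_mul, norm_mul]
    calc ‖F x‖ * ‖k x‖ * ‖∫ q : ℝ, (g q : ℂ) *
          Complex.exp (2 * Real.pi * Complex.I * ((m + x : ℝ) : ℂ) * q)‖
        ≤ (C * (1 + x ^ 2)⁻¹) * 8 * (B * (1 + (m + x) ^ 2)⁻¹) := by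
          gcongr
          · exact hC x
          · exact hkb x
          · exact hB (m + x)
      _ = 8 * C * B * ((1 + x ^ 2)⁻¹ * (1 + (m + x) ^ 2)⁻¹) := by ring
      _ ≤ 8 * C * B * (2 * (1 + m ^ 2)⁻¹ * ((1 + x ^ 2)⁻¹ + (1 + (m + x) ^ 2)⁻¹)) := by
          exact mul_le_mul_of_nonneg_left (inv_one_add_sq_mul_le x m) (by positivity)
      _ = _ := by ring
  · refine Integrable.bdd_mul (c := 1) (Integrable.mul_prod hg.ofReal hFk)
      (Continuous.aestronglyMeasurable (by fun_prop)) (ae_of_all _ fun z => ?_)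
    exact (norm_exp_two_pi_I_mul _ _).le

/-- The Fourier transform of `H f * g`, with `H f` a Hilbert transform, decays quadratically
when those of `f` and `g` do. -/
lemma norm_integral_hilbert_mul_exp_le (hf : Continuous f) {R : ℝ}
    (hR : ∀ x, R < |x| → f x = 0)
    (hC : ∀ x, ‖𝓕 (fun s => (f s : ℂ)) x‖ ≤ C * (1 + x ^ 2)⁻¹) {H : ℝ → ℝ}
    (hH : ∀ t : ℝ, Tendsto (fun δ : ℝ => ∫ s in {s : ℝ | δ < |t - s|}, f s / (t - s))
      (𝓝[>] (0 : ℝ)) (𝓝 (Real.pi * H t)))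
    {g : ℝ → ℝ} {B : ℝ} (hg : Continuous g) (hgs : HasCompactSupport g)
    (hB : ∀ x : ℝ, ‖∫ q : ℝ, (g q : ℂ) * Complex.exp (2 * Real.pi * Complex.I * x * q)‖
      ≤ B * (1 + x ^ 2)⁻¹) (m : ℝ) :
    ‖∫ q : ℝ, ((H q * g q : ℝ) : ℂ) * Complex.exp (2 * Real.pi * Complex.I * m * q)‖
      ≤ 32 * C * B * (1 + m ^ 2)⁻¹ := by
  have hgi : Integrable g := hg.integrable_of_hasCompactSupport hgs
  have hfi : Integrable f := by
    refine hf.integrable_of_hasCompactSupport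
      (HasCompactSupport.of_support_subset_isCompact (isCompact_Icc (a := -R) (b := R)) ?_)
    intro x hx
    by_contra hcon
    exact hx (hR x (by by_contra! h; exact hcon (abs_le.1 h)))
  obtain ⟨Q, hQ0, hQ⟩ := hgs.exists_pos_le_norm
  obtain ⟨N, hN0, hN⟩ : ∃ N : ℝ, 0 < N ∧ Q + R ≤ N :=
    ⟨max 1 (Q + R), by positivity, le_max_right _ _⟩
  have hδ : ∀ᶠ δ : ℝ in 𝓝[>] (0 : ℝ), 0 < δ ∧ δ < N :=
    Ioo_mem_nhdsGT hN0
  set P : ℝ → ℝ → ℝ := fun δ q => ∫ u in δ..N, (f (q - u) - f (q + u)) / u with hP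
  have hPm : ∀ δ, δ < N → Measurable (P δ) := fun δ hδN => by
    have : StronglyMeasurable fun q : ℝ => ∫ u in δ..N, (f (q - u) - f (q + u)) / u := by
      simp_rw [intervalIntegral.integral_of_le hδN.le]
      refine StronglyMeasurable.integral_prod_right
        (f := fun q u : ℝ => (f (q - u) - f (q + u)) / u) ?_
      refine Measurable.stronglyMeasurable ?_
      simp only [Function.uncurry_def]
      have := hf.measurable
      fun_prop
    exact this.measurable
  have hlim : Tendsto (fun δ : ℝ => ∫ q : ℝ, ((P δ q * g q : ℝ) : ℂ) *
      Complex.exp (2 * Real.pi * Complex.I * m * q)) (𝓝[>] (0 : ℝ))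
      (𝓝 (∫ q : ℝ, ((Real.pi * H q * g q : ℝ) : ℂ) *
        Complex.exp (2 * Real.pi * Complex.I * m * q))) := by
    refine tendsto_integral_filter_of_dominated_convergence
      (fun q => 8 * C * Real.pi * |g q|) ?_ ?_ (hgi.abs.const_mul _) ?_
    · filter_upwards [hδ] with δ h
      refine Measurable.aestronglyMeasurable ?_
      have := hPm δ h.2
      have := hg.measurable
      fun_prop
    · filter_upwards [hδ] with δ h
      refine ae_of_all _ fun q => ?_
      rw [norm_mul, norm_exp_two_pi_I_mul, mul_one, Complex.norm_real, Real.norm_eq_abs, abs_mul]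
      exact mul_le_mul_of_nonneg_right (abs_integral_sub_div_le hf hfi hC h.1 h.2.le q)
        (abs_nonneg _)
    · refine ae_of_all _ fun q => ?_
      refine Tendsto.mul_const _ ((Complex.continuous_ofReal.tendsto _).comp ?_)
      by_cases hq : Q ≤ |q|
      · simp [hQ q hq]
      · refine Tendsto.mul_const _ ((hH q).congr' ?_)
        filter_upwards [hδ] with δ h
        exact setIntegral_div_sub_eq hf hR (by linarith) h.1 h.2
  have hle := le_of_tendsto hlim.norm (b := 32 * C * B * Real.pi * (1 + m ^ 2)⁻¹) (by
    filter_upwards [hδ] with δ h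
    exact norm_integral_truncated_mul_exp_le hf hfi hC h.1 h.2.le hgi hB m)
  have e : ∫ q : ℝ, ((Real.pi * H q * g q : ℝ) : ℂ) *
        Complex.exp (2 * Real.pi * Complex.I * m * q)
      = Real.pi * ∫ q : ℝ, ((H q * g q : ℝ) : ℂ) *
        Complex.exp (2 * Real.pi * Complex.I * m * q) := by
    rw [← integral_const_mul]
    congr 1
    ext q
    push_cast
    ring
  rw [e, norm_mul, Complex.norm_real, Real.norm_eq_abs, abs_of_pos Real.pi_pos] at hle
  refine le_of_mul_le_mul_left (hle.trans_eq ?_) Real.pi_pos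
  ring

end TruncatedHilbert

lemma hilbert_deriv_eq_of_lt {g H : ℝ → ℝ} (hd : Differentiable ℝ g) (hc : Continuous (deriv g))
    {R : ℝ} (hR0 : 0 < R) (hR : ∀ x, R ≤ |x| → g x = 0) (hR' : ∀ x, R ≤ |x| → deriv g x = 0)
    (hH : ∀ t : ℝ, Tendsto (fun δ : ℝ => ∫ s in {s : ℝ | δ < |t - s|}, deriv g s / (t - s))
      (𝓝[>] (0 : ℝ)) (𝓝 (Real.pi * H t))) {q : ℝ} (hq : R < |q|) :
    H q = -Real.pi⁻¹ * ∫ s in (-R)..R, g s / (q - s) ^ 2 := by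
  have hab : -R ≤ R := by linarith
  have hne : ∀ s ∈ Set.uIcc (-R) R, q - s ≠ 0 := fun s hs h => by
    rw [Set.uIcc_of_le hab] at hs
    have : |q| ≤ R := by rw [show q = s by linarith]; exact abs_le.2 hs
    linarith
  have htrunc : ∀ᶠ δ : ℝ in 𝓝[>] (0 : ℝ),
      ∫ s in {s : ℝ | δ < |q - s|}, deriv g s / (q - s)
        = ∫ s in (-R)..R, deriv g s / (q - s) := by
    filter_upwards [Ioo_mem_nhdsGT (sub_pos.2 hq)] with δ hδ
    have hz : ∀ s, R ≤ |s| → deriv g s / (q - s) = 0 := fun s hs => by rw [hR' s hs, zero_div]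
    rw [setIntegral_eq_integral_of_forall_compl_eq_zero,
      intervalIntegral.integral_eq_integral_of_support_subset]
    · intro s hs
      by_contra hcon
      refine hs (hz s ?_)
      by_contra! h
      exact hcon ⟨(abs_lt.1 h).1, (abs_lt.1 h).2.le⟩
    · intro s hs
      refine hz s ?_
      have h1 : |q - s| ≤ δ := not_lt.1 hs
      have h2 := abs_sub_abs_le_abs_sub q s
      linarith [hδ.2]
  have hlim := tendsto_nhds_unique (hH q)
    ((tendsto_congr' htrunc).2 tendsto_const_nhds)
  have i1 : IntervalIntegrable (fun s => deriv g s / (q - s)) volume (-R) R :=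
    ContinuousOn.intervalIntegrable (hc.continuousOn.div (by fun_prop) hne)
  have i2 : IntervalIntegrable (fun s => g s / (q - s) ^ 2) volume (-R) R :=
    ContinuousOn.intervalIntegrable (hd.continuous.continuousOn.div (by fun_prop)
      fun s hs => pow_ne_zero 2 (hne s hs))
  have key : ∫ s in (-R)..R, (deriv g s / (q - s) + g s / (q - s) ^ 2)
      = g R / (q - R) - g (-R) / (q - -R) := by
    refine intervalIntegral.integral_eq_sub_of_hasDerivAt (f := fun s => g s / (q - s)) ?_
      (i1.add i2)
    intro s hs
    have h0 := hne s hs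
    refine ((hd s).hasDerivAt.div ((hasDerivAt_id s).const_sub q) h0).congr_deriv ?_
    simp only [id]
    field_simp
    ring
  rw [intervalIntegral.integral_add i1 i2, hR R (le_abs_self R),
    hR (-R) ((le_abs_self R).trans_eq (abs_neg R).symm), ← hlim, zero_div,
    zero_div, sub_zero] at key
  have hpi := Real.pi_pos
  field_simp
  linarith

lemma norm_integral_div_sq_mul_exp_le {w : ℝ → ℝ} (hd : Differentiable ℝ w)
    (hd' : Differentiable ℝ (deriv w)) {M R c d : ℝ} (hR0 : 0 < R)
    (hR : ∀ x, R ≤ |x| → w x = 0) (hR' : ∀ x, R ≤ |x| → deriv w x = 0)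
    (hM : ∀ x, |w x| ≤ M) (hM' : ∀ x, |deriv w x| ≤ M) (hM'' : ∀ᵐ x : ℝ, |deriv (deriv w) x| ≤ M)
    (h1d : 1 ≤ d) (hcd : ∀ p ∈ Set.Icc (-R) R, d ≤ |p - c|) (x : ℝ) :
    ‖∫ p in (-R)..R, ((w p / (p - c) ^ 2 : ℝ) : ℂ) *
      Complex.exp (2 * Real.pi * Complex.I * x * p)‖
      ≤ 44 * M * R / d ^ 2 * (1 + x ^ 2)⁻¹ := by
  have hM0 : 0 ≤ M := (abs_nonneg _).trans (hM 0)
  have hne : ∀ p ∈ Set.Icc (-R) R, p - c ≠ 0 := fun p hp h => by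
    have := hcd p hp
    rw [h, abs_zero] at this
    linarith
  have hRa : R ≤ |R| := le_abs_self R
  have hRb : R ≤ |(-R)| := by rw [abs_neg]; exact hRa
  have hd0 : 0 < d := by linarith
  have hinv : ∀ p ∈ Set.Icc (-R) R, ∀ (y : ℝ) (n : ℕ), 2 ≤ n → |y| ≤ M →
      |y / (p - c) ^ n| ≤ M / d ^ 2 := fun p hp y n hn hy => by
    rw [abs_div, abs_pow]
    have h2 : d ^ 2 ≤ |p - c| ^ n :=
      (pow_le_pow_left₀ hd0.le (hcd p hp) 2).trans
        (pow_le_pow_right₀ (h1d.trans (hcd p hp)) hn)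
    exact div_le_div₀ hM0 hy (by positivity) h2
  have h := norm_integral_mul_exp_le (a := -R) (b := R) (K := 11 * M / d ^ 2)
    (h := fun p => w p / (p - c) ^ 2)
    (h' := fun p => deriv w p / (p - c) ^ 2 - 2 * (w p / (p - c) ^ 3))
    (h'' := fun p => deriv (deriv w) p / (p - c) ^ 2 - 4 * (deriv w p / (p - c) ^ 3)
      + 6 * (w p / (p - c) ^ 4)) (by linarith) ?_ ?_ ?_ ?_ ?_ ?_ ?_ ?_ ?_ x
  · refine h.trans_eq ?_
    ring
  · intro p hp
    have h0 := hne p hp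
    refine ((hd p).hasDerivAt.div (((hasDerivAt_id p).sub_const c).pow 2)
      (pow_ne_zero 2 h0)).congr_deriv ?_
    simp only [id, Pi.pow_apply]
    field_simp
    push_cast
    ring
  · intro p hp
    have h0 := hne p hp
    refine (((hd' p).hasDerivAt.div (((hasDerivAt_id p).sub_const c).pow 2)
      (pow_ne_zero 2 h0)).sub (((hd p).hasDerivAt.div (((hasDerivAt_id p).sub_const c).pow 3)
      (pow_ne_zero 3 h0)).const_mul 2)).congr_deriv ?_
    simp only [id, Pi.pow_apply]
    field_simp
    push_cast
    ring
  · have m1 := measurable_deriv (deriv w)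
    have m2 := measurable_deriv w
    have m3 := hd.continuous.measurable
    fun_prop
  · intro p hp
    refine (hinv p hp _ 2 le_rfl (hM p)).trans ?_
    gcongr
    linarith
  · filter_upwards [hM''] with p h2 hp
    have b1 := abs_le.1 (hinv p hp _ 2 le_rfl h2)
    have b2 := abs_le.1 (hinv p hp _ 3 (by norm_num) (hM' p))
    have b3 := abs_le.1 (hinv p hp _ 4 (by norm_num) (hM p))
    rw [mul_div_assoc, abs_le]
    constructor <;> linarith [b1.1, b1.2, b2.1, b2.2, b3.1, b3.2]
  · simp [hR _ hRb]
  · simp [hR _ hRa]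
  · simp [hR _ hRb, hR' _ hRb]
  · simp [hR _ hRa, hR' _ hRa]

lemma norm_integral_hilbert_deriv_mul_exp_le_of_le {w g H : ℝ → ℝ} (hd : Differentiable ℝ w)
    (hd' : Differentiable ℝ (deriv w)) (hg : Differentiable ℝ g) (hg' : Continuous (deriv g))
    {M R : ℝ} (hR1 : 1 ≤ R)
    (hR : ∀ x, R ≤ |x| → w x = 0) (hR' : ∀ x, R ≤ |x| → deriv w x = 0)
    (hgR : ∀ x, R ≤ |x| → g x = 0) (hgR' : ∀ x, R ≤ |x| → deriv g x = 0)
    (hM : ∀ x, |w x| ≤ M) (hM' : ∀ x, |deriv w x| ≤ M) (hM'' : ∀ᵐ x : ℝ, |deriv (deriv w) x| ≤ M)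
    (hgM : ∀ x, |g x| ≤ M)
    (hH : ∀ t : ℝ, Tendsto (fun δ : ℝ => ∫ s in {s : ℝ | δ < |t - s|}, deriv g s / (t - s))
      (𝓝[>] (0 : ℝ)) (𝓝 (Real.pi * H t))) {t : ℝ} (ht : 3 * R ≤ |t|) (m : ℝ) :
    ‖∫ q : ℝ, ((H q * w (-q - t) : ℝ) : ℂ) * Complex.exp (2 * Real.pi * Complex.I * m * q)‖
      ≤ 792 * M ^ 2 * R ^ 2 * (1 + m ^ 2)⁻¹ * (t ^ 2)⁻¹ := by
  have hR0 : 0 < R := by linarith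
  have hM0 : 0 ≤ M := (abs_nonneg _).trans (hM 0)
  have ht0 : 0 < |t| := by linarith
  have hpi1 : Real.pi⁻¹ ≤ 1 := inv_le_one_of_one_le₀ (by linarith [Real.pi_gt_three])
  have hlow : ∀ p s : ℝ, |p| ≤ R → |s| ≤ R → |t| / 3 ≤ |p - -(t + s)| := fun p s hp hs => by
    have h1 := abs_sub_abs_le_abs_sub t (-(p + s))
    rw [abs_neg] at h1
    have h2 := abs_add_le p s
    rw [show p - -(t + s) = t - -(p + s) by ring]
    linarith
  set Φ : ℝ → ℝ → ℂ := fun s q => ((-Real.pi⁻¹ * g s * (w (-q - t) / (q - s) ^ 2) : ℝ) : ℂ) *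
    Complex.exp (2 * Real.pi * Complex.I * m * q) with hΦ
  have hrep : ∀ q : ℝ, ((H q * w (-q - t) : ℝ) : ℂ) *
      Complex.exp (2 * Real.pi * Complex.I * m * q) = ∫ s in (-R)..R, Φ s q := by
    intro q
    rw [hΦ]
    simp only
    rw [intervalIntegral.integral_mul_const, intervalIntegral.integral_ofReal]
    congr 2
    by_cases hq : R ≤ |-q - t|
    · simp [hR _ hq]
    · have hqR : R < |q| := by
        have h1 := abs_sub_abs_le_abs_sub t (-q)
        rw [abs_neg, ← abs_neg (t - -q), show -(t - -q) = -q - t by ring] at h1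
        linarith
      rw [hilbert_deriv_eq_of_lt hg hg' hR0 hgR hgR' hH hqR, ← intervalIntegral.integral_const_mul,
        ← intervalIntegral.integral_mul_const]
      congr 1
      ext s
      ring
  simp_rw [hrep]
  have hΦb : ∀ s q : ℝ, ‖Φ s q‖ ≤ (M * (9 / t ^ 2)) * |w (-q - t)| := by
    intro s q
    rw [norm_mul, norm_exp_two_pi_I_mul, mul_one, Complex.norm_real, Real.norm_eq_abs]
    by_cases hq : R ≤ |-q - t|
    · simp [hR _ hq]
    by_cases hs : R ≤ |s|
    · rw [hgR _ hs]
      simp only [mul_zero, zero_mul, abs_zero]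
      positivity
    rw [abs_mul, abs_mul, abs_neg, abs_of_pos (inv_pos.2 Real.pi_pos), abs_div, abs_pow]
    have h1 := hlow (-q - t) s (by linarith) (by linarith)
    rw [show -q - t - -(t + s) = -(q - s) by ring, abs_neg] at h1
    have h2 : |t| ^ 2 / 9 ≤ |q - s| ^ 2 := by
      have := pow_le_pow_left₀ (by positivity) h1 2
      linarith
    have h3 : |w (-q - t)| / |q - s| ^ 2 ≤ 9 / t ^ 2 * |w (-q - t)| := by
      rw [← sq_abs t, div_eq_mul_inv, mul_comm]
      refine mul_le_mul_of_nonneg_right ?_ (abs_nonneg _)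
      rw [← inv_div]
      exact inv_anti₀ (by positivity) h2
    calc Real.pi⁻¹ * |g s| * (|w (-q - t)| / |q - s| ^ 2)
        ≤ 1 * M * (9 / t ^ 2 * |w (-q - t)|) := by
          gcongr
          exact hgM s
      _ = _ := by ring
  have hwc : HasCompactSupport w :=
    HasCompactSupport.of_support_subset_isCompact (isCompact_Icc (a := -R) (b := R)) fun x hx => by
      by_contra hcon
      exact hx (hR x (by by_contra! h; exact hcon (abs_le.1 h.le)))
  have hwi : Integrable fun q : ℝ => |w (-q - t)| := by
    have hi : Integrable w := hd.continuous.integrable_of_hasCompactSupport hwc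
    have := hi.comp_sub_left (-t)
    refine (this.congr (ae_of_all _ fun q => ?_)).abs
    simp only
    congr 1
    ring
  rw [← intervalIntegral_integral_swap]
  · have hin : ∀ s ∈ Set.uIoc (-R) R, ‖∫ q : ℝ, Φ s q‖
        ≤ M * (396 * M * R * (t ^ 2)⁻¹ * (1 + m ^ 2)⁻¹) := by
      intro s hs
      rw [Set.uIoc_of_le (by linarith)] at hs
      have hsR : |s| ≤ R := abs_le.2 ⟨hs.1.le, hs.2⟩
      have e : ∫ q : ℝ, Φ s q = (((-Real.pi⁻¹ * g s : ℝ) : ℂ) *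
          Complex.exp (2 * Real.pi * Complex.I * m * ((-t : ℝ) : ℂ))) *
          ∫ p in (-R)..R, ((w p / (p - -(t + s)) ^ 2 : ℝ) : ℂ) *
            Complex.exp (2 * Real.pi * Complex.I * ((-m : ℝ) : ℂ) * p) := by
        rw [intervalIntegral.integral_eq_integral_of_support_subset,
          ← integral_sub_left_eq_self _ volume (-t), ← integral_const_mul]
        · congr 1
          ext p
          have e1 : Complex.exp (2 * Real.pi * Complex.I * m * ((-t - p : ℝ) : ℂ))
              = Complex.exp (2 * Real.pi * Complex.I * m * ((-t : ℝ) : ℂ)) *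
                Complex.exp (2 * Real.pi * Complex.I * ((-m : ℝ) : ℂ) * p) := by
            rw [← Complex.exp_add]; congr 1; push_cast; ring
          have e2 : w (-(-t - p) - t) / (-t - p - s) ^ 2 = w p / (p - -(t + s)) ^ 2 := by
            congr 1
            · congr 1
              ring
            · ring
          simp only [hΦ]
          rw [e1, e2, Complex.ofReal_mul]
          ring
        · intro p hp
          by_contra hcon
          refine hp ?_
          beta_reduce
          rw [hR p (by by_contra! h; exact hcon ⟨(abs_lt.1 h).1, (abs_lt.1 h).2.le⟩)]
          simp
      have hk := norm_integral_div_sq_mul_exp_le hd hd' hR0 hR hR' hM hM' hM'' (c := -(t + s))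
        (d := |t| / 3) (by linarith) (fun p hp => hlow p s (abs_le.2 hp) hsR) (-m)
      rw [e, norm_mul, norm_mul, norm_exp_two_pi_I_mul, mul_one, Complex.norm_real,
        Real.norm_eq_abs, abs_mul, abs_neg, abs_of_pos (inv_pos.2 Real.pi_pos)]
      have hc : Real.pi⁻¹ * |g s| ≤ M := by
        nlinarith [mul_le_mul hpi1 (hgM s) (abs_nonneg _) zero_le_one]
      refine mul_le_mul hc (hk.trans_eq ?_) (norm_nonneg _) hM0
      rw [div_pow, sq_abs, neg_sq]
      field_simp
      ring
    refine (intervalIntegral.norm_integral_le_of_norm_le_const hin).trans_eq ?_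
    rw [abs_of_nonneg (by linarith)]
    ring
  · have hdom : Integrable (fun z : ℝ × ℝ => (M * (9 / t ^ 2)) * |w (-z.2 - t)|)
        ((volume.restrict (Set.uIoc (-R) R)).prod volume) :=
      Integrable.mul_prod (f := fun _ : ℝ => M * (9 / t ^ 2)) (g := fun q => |w (-q - t)|)
        (intervalIntegrable_iff.1 intervalIntegrable_const) hwi
    refine hdom.mono' (Measurable.aestronglyMeasurable ?_) (ae_of_all _ fun z => hΦb z.1 z.2)
    have m1 := hg.continuous.measurable
    have m2 := hd.continuous.measurable
    simp only [Function.uncurry_def, hΦ]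
    fun_prop

/-- the Fourier coefficients
`ψ̃_m(t) = ∫_ℝ (𝓗 ik')(q) w(−q−t) e^{2πimq} dq` satisfy
`|ψ̃_m(t)| ≤ c (1+m²)⁻¹ (1+t²)⁻¹`; in particular the Fourier series
`Σ_m ψ̃_m(t) e^{−2πimq}` converges absolutely. -/
theorem stmt_11 (w ik Hikp : ℝ → ℝ)
    -- the detector aperture function w ∈ C₀²(ℝ), even, with ∫ w = 1
    (hw_even : ∀ p : ℝ, w (-p) = w p)
    (hw_supp : HasCompactSupport w)
    (hw_d1 : ∀ p : ℝ, DifferentiableAt ℝ w p)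
    (hw_d2 : ∀ p : ℝ, DifferentiableAt ℝ (deriv w) p)
    (hw_bdd : ∃ M : ℝ, ∀ᵐ p : ℝ, |deriv (deriv w) p| ≤ M)
    (hw_int : ∫ p : ℝ, w p = 1)
    -- the interpolation kernel ik ∈ C₀²(ℝ), even, exact up to order 1
    (hik_even : ∀ p : ℝ, ik (-p) = ik p)
    (hik_supp : HasCompactSupport ik)
    (hik_d1 : ∀ p : ℝ, DifferentiableAt ℝ ik p)
    (hik_d2 : ∀ p : ℝ, DifferentiableAt ℝ (deriv ik) p)
    (hik_bdd : ∃ M : ℝ, ∀ᵐ p : ℝ, |deriv (deriv ik) p| ≤ M)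
    (hik_exact0 : ∀ u : ℝ, ∑' j : ℤ, ik (u - (j : ℝ)) = 1)
    (hik_exact1 : ∀ u : ℝ, ∑' j : ℤ, (j : ℝ) * ik (u - (j : ℝ)) = u)
    -- additionally, ĩk(λ) = O(|λ|⁻³)
    (hik_decay : ∃ Cd : ℝ, ∀ l : ℝ, 1 ≤ |l| →
      ‖∫ x : ℝ, (ik x : ℂ) * Complex.exp (Complex.I * l * x)‖ ≤ Cd / |l| ^ 3)
    -- Hikp is the Hilbert transform of ik'
    (hHikp : ∀ t : ℝ, Tendsto
      (fun δ : ℝ => ∫ s in {s : ℝ | δ < |t - s|}, deriv ik s / (t - s))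
      (𝓝[>] (0:ℝ)) (𝓝 (Real.pi * Hikp t)))
    -- the Fourier coefficients ψ̃_m
    (ψt : ℤ → ℝ → ℂ)
    (hψt : ∀ m : ℤ, ∀ t : ℝ, ψt m t =
      ∫ q : ℝ, ((Hikp q * w (-q - t) : ℝ) : ℂ) *
        Complex.exp (2 * Real.pi * Complex.I * (m : ℂ) * (q : ℂ))) :
    (∃ c : ℝ, 0 < c ∧ ∀ m : ℤ, ∀ t : ℝ,
      ‖ψt m t‖ ≤ c * (1 + (m : ℝ) ^ 2)⁻¹ * (1 + t ^ 2)⁻¹) ∧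
    (∀ q t : ℝ, Summable fun m : ℤ =>
      ‖ψt m t * Complex.exp (-(2 * Real.pi * Complex.I * (m : ℂ) * (q : ℂ)))‖) := by
  obtain ⟨Mw, hMw⟩ := hw_bdd
  have hwd : Differentiable ℝ w := hw_d1
  have hwd' : Differentiable ℝ (deriv w) := hw_d2
  have hgd : Differentiable ℝ ik := hik_d1
  have hgc' : Continuous (deriv ik) := (show Differentiable ℝ (deriv ik) from hik_d2).continuous
  obtain ⟨R1, -, h1⟩ := hw_supp.exists_pos_le_norm
  obtain ⟨R2, -, h2⟩ := hw_supp.deriv.exists_pos_le_norm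
  obtain ⟨R3, -, h3⟩ := hik_supp.exists_pos_le_norm
  obtain ⟨R4, -, h4⟩ := hik_supp.deriv.exists_pos_le_norm
  obtain ⟨M1, hM1⟩ := hwd.continuous.bounded_above_of_compact_support hw_supp
  obtain ⟨M2, hM2⟩ := hwd'.continuous.bounded_above_of_compact_support hw_supp.deriv
  obtain ⟨M3, hM3⟩ := hgd.continuous.bounded_above_of_compact_support hik_supp
  obtain ⟨R, hR1, hRw, hRw', hRg, hRg'⟩ : ∃ R : ℝ, 1 ≤ R ∧ (∀ x, R ≤ |x| → w x = 0) ∧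
      (∀ x, R ≤ |x| → deriv w x = 0) ∧ (∀ x, R ≤ |x| → ik x = 0) ∧
      (∀ x, R ≤ |x| → deriv ik x = 0) := by
    refine ⟨max 1 (max (max R1 R2) (max R3 R4)), le_max_left _ _, fun x hx => h1 x ?_,
      fun x hx => h2 x ?_, fun x hx => h3 x ?_, fun x hx => h4 x ?_⟩ <;>
    · simp only [max_le_iff] at hx
      tauto
  obtain ⟨M, hM, hM', hM'', hgM⟩ : ∃ M : ℝ, (∀ x, |w x| ≤ M) ∧ (∀ x, |deriv w x| ≤ M) ∧
      (∀ᵐ x : ℝ, |deriv (deriv w) x| ≤ M) ∧ ∀ x, |ik x| ≤ M := by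
    refine ⟨max (max M1 M2) (max M3 Mw), fun x => (hM1 x).trans (by simp),
      fun x => (hM2 x).trans (by simp), ?_, fun x => (hM3 x).trans (by simp)⟩
    filter_upwards [hMw] with x hx
    exact hx.trans (by simp)
  obtain ⟨C, hC⟩ := exists_norm_fourier_deriv_le hik_supp hgd hgc' hik_decay
  have hC0 : 0 ≤ C := by simpa using (norm_nonneg _).trans (hC 0)
  have hM0 : 0 ≤ M := (abs_nonneg _).trans (hM 0)
  have hw_fourier : ∀ t x : ℝ, ‖∫ q : ℝ, (w (-q - t) : ℂ) *
      Complex.exp (2 * Real.pi * Complex.I * x * q)‖ ≤ 4 * M * R * (1 + x ^ 2)⁻¹ := by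
    intro t x
    have hRa : R ≤ |R| := le_abs_self R
    have hRb : R ≤ |(-R)| := by rw [abs_neg]; exact hRa
    have h := norm_integral_mul_exp_le (a := -R) (b := R) (K := M) (by linarith)
      (fun p _ => (hwd p).hasDerivAt) (fun p _ => (hwd' p).hasDerivAt)
      (measurable_deriv _) (fun p _ => hM p) (hM''.mono fun p hp _ => hp)
      (hRw _ hRb) (hRw _ hRa) (hRw' _ hRb) (hRw' _ hRa) (-x)
    have e : ∫ q : ℝ, (w (-q - t) : ℂ) * Complex.exp (2 * Real.pi * Complex.I * x * q)
        = Complex.exp (2 * Real.pi * Complex.I * x * ((-t : ℝ) : ℂ)) *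
          ∫ p in (-R)..R, (w p : ℂ) *
            Complex.exp (2 * Real.pi * Complex.I * ((-x : ℝ) : ℂ) * p) := by
      rw [intervalIntegral.integral_eq_integral_of_support_subset,
        ← integral_sub_left_eq_self _ volume (-t), ← integral_const_mul]
      · congr 1
        ext p
        have e1 : Complex.exp (2 * Real.pi * Complex.I * x * ((-t - p : ℝ) : ℂ))
            = Complex.exp (2 * Real.pi * Complex.I * x * ((-t : ℝ) : ℂ)) *
              Complex.exp (2 * Real.pi * Complex.I * ((-x : ℝ) : ℂ) * p) := by
          rw [← Complex.exp_add]; congr 1; push_cast; ring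
        rw [e1, show -(-t - p) - t = p by ring]
        ring
      · intro p hp
        by_contra hcon
        refine hp ?_
        beta_reduce
        rw [hRw p (by by_contra! h; exact hcon ⟨(abs_lt.1 h).1, (abs_lt.1 h).2.le⟩)]
        simp
    rw [e, norm_mul, norm_exp_two_pi_I_mul, one_mul]
    refine h.trans_eq ?_
    rw [neg_sq]
    ring
  have hnear : ∀ (m : ℤ) (t : ℝ), ‖ψt m t‖ ≤ 32 * C * (4 * M * R) * (1 + (m : ℝ) ^ 2)⁻¹ := by
    intro m t
    have hcont : Continuous fun q : ℝ => w (-q - t) := hwd.continuous.comp (by fun_prop)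
    have hsupp : HasCompactSupport fun q : ℝ => w (-q - t) := by
      refine HasCompactSupport.of_support_subset_isCompact
        (isCompact_Icc (a := -t - R) (b := -t + R)) fun q hq => ?_
      by_contra hcon
      refine hq (hRw _ ?_)
      by_contra! h
      have := abs_lt.1 h
      exact hcon ⟨by linarith, by linarith⟩
    have h := norm_integral_hilbert_mul_exp_le hgc' (fun x hx => hRg' x hx.le) hC hHikp hcont
      hsupp (hw_fourier t) (m : ℝ)
    rw [hψt]
    simpa using h
  have hfar : ∀ (m : ℤ) (t : ℝ), 3 * R ≤ |t| →
      ‖ψt m t‖ ≤ 792 * M ^ 2 * R ^ 2 * (1 + (m : ℝ) ^ 2)⁻¹ * (t ^ 2)⁻¹ := by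
    intro m t ht
    have h := norm_integral_hilbert_deriv_mul_exp_le_of_le hwd hwd' hgd hgc' hR1 hRw hRw' hRg hRg'
      hM hM' hM'' hgM hHikp ht (m : ℝ)
    rw [hψt]
    simpa using h
  have hmain : ∃ c : ℝ, 0 < c ∧ ∀ m : ℤ, ∀ t : ℝ,
      ‖ψt m t‖ ≤ c * (1 + (m : ℝ) ^ 2)⁻¹ * (1 + t ^ 2)⁻¹ := by
    refine ⟨32 * C * (4 * M * R) * (1 + 9 * R ^ 2) + 2 * (792 * M ^ 2 * R ^ 2) + 1,
      by positivity, fun m t => ?_⟩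
    set A := 32 * C * (4 * M * R) with hA
    set B := 792 * M ^ 2 * R ^ 2 with hB
    have hA0 : 0 ≤ A := by positivity
    have hB0 : 0 ≤ B := by positivity
    rw [mul_right_comm]
    rcases le_total (3 * R) |t| with ht | ht
    · refine (hfar m t ht).trans ?_
      rw [mul_right_comm]
      refine mul_le_mul_of_nonneg_right ?_ (by positivity)
      have ht2 : 1 ≤ t ^ 2 := by rw [← sq_abs]; nlinarith
      rw [← div_eq_mul_inv, ← div_eq_mul_inv, div_le_div_iff₀ (by positivity) (by positivity)]
      nlinarith [mul_le_mul_of_nonneg_left ht2 hB0, mul_nonneg hA0 (sq_nonneg R),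
        mul_nonneg (mul_nonneg hA0 (sq_nonneg R)) (sq_nonneg t), mul_nonneg hA0 (sq_nonneg t)]
    · refine (hnear m t).trans (mul_le_mul_of_nonneg_right ?_ (by positivity))
      have ht2 : t ^ 2 ≤ 9 * R ^ 2 := by rw [← sq_abs]; nlinarith [abs_nonneg t]
      rw [← div_eq_mul_inv, le_div_iff₀ (by positivity)]
      nlinarith [mul_le_mul_of_nonneg_left ht2 hA0]
  refine ⟨hmain, fun q t => ?_⟩
  obtain ⟨c, -, hc⟩ := hmain
  have hsum : Summable fun m : ℤ => (1 + (m : ℝ) ^ 2)⁻¹ := by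
    refine Summable.of_norm_bounded_eventually (g := fun m : ℤ => 1 / (m : ℝ) ^ 2)
      (Real.summable_one_div_int_pow.2 (by norm_num)) ?_
    filter_upwards [(Set.finite_singleton (0 : ℤ)).compl_mem_cofinite] with m hm
    have hm0 : (m : ℝ) ≠ 0 := by exact_mod_cast hm
    rw [Real.norm_eq_abs, abs_of_pos (by positivity), one_div]
    exact inv_anti₀ (by positivity) (by linarith)
  refine Summable.of_nonneg_of_le (fun m => norm_nonneg _) (fun m => ?_)
    ((hsum.mul_left c).mul_right (1 + t ^ 2)⁻¹)
  have he : ‖Complex.exp (-(2 * Real.pi * Complex.I * (m : ℂ) * (q : ℂ)))‖ = 1 := by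
    rw [← norm_exp_two_pi_I_mul m (-q)]
    congr 2
    push_cast
    ring
  rw [norm_mul, he, mul_one]
  exact hc m t
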